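/- Endow SU(d) (d ≥ 2) with its bi-invariant Riemannian metric. If γ₀, γ₁ : [0,1] → SU(d) are two minimising geodesics from the identity to a point g ∈ SU(d), then there exists ξ ∈ 𝔰𝔲(d) = {M ∈ M_d(ℂ) : M* = −M, tr M = 0} such that g = exp(tξ) g exp(−tξ) for every t ∈ [0,1], and γ₁(s) = exp(ξ) γ₀(s) exp(−ξ) for every s ∈ [0,1]. In particular, γ₀ is homotopied to γ₁ through the minimising geodesics γ_t(s) = exp(tξ) γ₀(s) exp(−tξ), t ∈ [0,1]. -/

import Mathlib

open MeasureTheory Metric Set Filter Topology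
open scoped ENNReal NNReal

noncomputable section

namespace Paper

/-- The plane `ℝ²`. -/
abbrev R2 : Type := EuclideanSpace ℝ (Fin 2)

/-- The period `2π` used to parametrise the circle `S¹` by `ℝ`. -/
def tp : ℝ := 2 * Real.pi

/-- The standard parametrisation of the unit circle in the plane. -/
def sc (t : ℝ) : R2 := (EuclideanSpace.equiv (Fin 2) ℝ).symm ![Real.cos t, Real.sin t]

variable {E : Type*} [NormedAddCommGroup E] [NormedSpace ℝ E]

/-- A loop with values in `N`, `2π`-periodically parametrised by `ℝ`. -/
def IsLoopIn (N : Set E) (γ : ℝ → E) : Prop :=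
  Function.Periodic γ tp ∧ ∀ t, γ t ∈ N

/-- The length of a loop. -/
def loopLength (γ : ℝ → E) : ℝ := ∫ t in (0:ℝ)..tp, ‖deriv γ t‖

/-- Mean oscillation of `f` over the interval `(a - r, a + r)`. -/
def meanOsc (f : ℝ → E) (a r : ℝ) : ℝ≥0∞ :=
  (∫⁻ s in Set.Ioo (a - r) (a + r), ∫⁻ t in Set.Ioo (a - r) (a + r),
      (‖f s - f t‖₊ : ℝ≥0∞)) / (ENNReal.ofReal (2 * r)) ^ 2

/-- `f` has vanishing mean oscillation. -/
def IsVMO (f : ℝ → E) : Prop :=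
  AEStronglyMeasurable f volume ∧
    Tendsto (fun δ : ℝ => ⨆ a : ℝ, ⨆ r ∈ Set.Ioc (0:ℝ) δ, meanOsc f a r)
      (nhdsWithin 0 (Set.Ioi 0)) (nhds 0)

/-- A distance inducing the `VMO` topology (a BMO-type part plus an `L¹` part). -/
def vmoDist (f g : ℝ → E) : ℝ≥0∞ :=
  (⨆ a : ℝ, ⨆ r ∈ Set.Ioc (0:ℝ) (1:ℝ), meanOsc (fun t => f t - g t) a r)
    + ∫⁻ t in Set.Ioo (0:ℝ) tp, (‖f t - g t‖₊ : ℝ≥0∞)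

/-- Membership in `VMO(S¹, N)`. -/
def MemVMOLoop (N : Set E) (f : ℝ → E) : Prop :=
  Function.Periodic f tp ∧ (∀ᵐ t : ℝ, f t ∈ N) ∧ IsVMO f

/-- Two maps are homotopic in `VMO(S¹, N)`: they are joined by a path of `VMO` loops
which is continuous for the `VMO` distance. -/
def VMOHomotopic (N : Set E) (f g : ℝ → E) : Prop :=
  ∃ H : ℝ → ℝ → E,
    (∀ s ∈ Set.Icc (0:ℝ) 1, MemVMOLoop N (H s)) ∧
    (∀ s₀ ∈ Set.Icc (0:ℝ) 1,
      Tendsto (fun s => vmoDist (H s) (H s₀)) (nhdsWithin s₀ (Set.Icc 0 1)) (nhds 0)) ∧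
    H 0 = f ∧ H 1 = g

/-- Minimal length `λ(γ)` in the `VMO`-homotopy class of `γ`. -/
def minLength (N : Set E) (γ : ℝ → E) : ℝ :=
  sInf { L : ℝ | ∃ γ' : ℝ → E, ContDiff ℝ 1 γ' ∧ IsLoopIn N γ' ∧ VMOHomotopic N γ' γ ∧
    L = loopLength γ' }

/-- A minimising closed geodesic: a constant-speed `C¹` loop whose length is minimal
in its free homotopy class. -/
def IsMinGeodesic (N : Set E) (γ : ℝ → E) : Prop :=
  ContDiff ℝ 1 γ ∧ IsLoopIn N γ ∧ loopLength γ = minLength N γ ∧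
  ∀ s t : ℝ, ‖deriv γ s‖ = ‖deriv γ t‖

/-- Gagliardo `W^{1/2,2}` seminorm of a loop. -/
def gagliardo (γ : ℝ → E) : ℝ≥0∞ :=
  ∫⁻ s in Set.Ioo (0:ℝ) tp, ∫⁻ t in Set.Ioo (0:ℝ) tp,
    ((‖γ s - γ t‖₊ : ℝ≥0∞)) ^ 2 / (ENNReal.ofReal (dist s t)) ^ 2

/-- Membership in `W^{1/2,2}(S¹, N)`. -/
def MemW12HalfLoop (N : Set E) (γ : ℝ → E) : Prop :=
  Function.Periodic γ tp ∧ AEStronglyMeasurable γ volume ∧ (∀ᵐ t : ℝ, γ t ∈ N) ∧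
  gagliardo γ < ⊤ ∧ (∫⁻ t in Set.Ioo (0:ℝ) tp, (‖γ t‖₊ : ℝ≥0∞) ^ 2) < ⊤

/-- Strong convergence in `W^{1/2,2}(S¹, E)`. -/
def W12HalfTendsto (γn : ℕ → ℝ → E) (γ : ℝ → E) : Prop :=
  Tendsto (fun n => gagliardo (fun t => γn n t - γ t)
      + ∫⁻ t in Set.Ioo (0:ℝ) tp, (‖γn n t - γ t‖₊ : ℝ≥0∞) ^ 2) atTop (nhds 0)

/-- Squared Frobenius norm of a linear map on the plane. -/
def fro2 (L : R2 →L[ℝ] E) : ℝ := ∑ i : Fin 2, ‖L (EuclideanSpace.single i (1:ℝ))‖ ^ 2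

/-- Dirichlet energy `∫_A |Du|²/2`. -/
def dirE (A : Set R2) (u : R2 → E) : ℝ := ∫ x in A, fro2 (fderiv ℝ u x) / 2

/-- Membership in `W^{1,2}(A, N)`. -/
def MemW12 (A : Set R2) (N : Set E) (u : R2 → E) : Prop :=
  AEStronglyMeasurable u (volume.restrict A) ∧
  (∀ᵐ x ∂volume.restrict A, u x ∈ N) ∧
  (∀ᵐ x ∂volume.restrict A, DifferentiableAt ℝ u x) ∧
  (∫⁻ x in A, ENNReal.ofReal (fro2 (fderiv ℝ u x))) < ⊤

/-- Squared Frobenius norm of a linear map on the cylinder `ℝ × ℝ`. -/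
def fro2' (L : ℝ × ℝ →L[ℝ] E) : ℝ := ‖L (1, 0)‖ ^ 2 + ‖L (0, 1)‖ ^ 2

/-- Dirichlet energy on the cylinder `S¹ × [0, T]`. -/
def cylEnergy (T : ℝ) (u : ℝ × ℝ → E) : ℝ :=
  ∫ p in (Set.Ioo (0:ℝ) tp) ×ˢ (Set.Ioo (0:ℝ) T), fro2' (fderiv ℝ u p) / 2

/-- Membership in `W^{1,2}(S¹ × [0,T], N)`. -/
def MemW12Cyl (T : ℝ) (N : Set E) (u : ℝ × ℝ → E) : Prop :=
  (∀ s t : ℝ, u (s + tp, t) = u (s, t)) ∧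
  AEStronglyMeasurable u (volume.restrict ((Set.Ioo (0:ℝ) tp) ×ˢ (Set.Ioo (0:ℝ) T))) ∧
  (∀ᵐ p ∂volume.restrict ((Set.Ioo (0:ℝ) tp) ×ˢ (Set.Ioo (0:ℝ) T)), u p ∈ N) ∧
  (∀ᵐ p ∂volume.restrict ((Set.Ioo (0:ℝ) tp) ×ˢ (Set.Ioo (0:ℝ) T)), DifferentiableAt ℝ u p) ∧
  (∫⁻ p in (Set.Ioo (0:ℝ) tp) ×ˢ (Set.Ioo (0:ℝ) T), ENNReal.ofReal (fro2' (fderiv ℝ u p))) < ⊤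

/-- Synharmony between two loops `γ` and `β`. -/
def synhar (N : Set E) (γ β : ℝ → E) : EReal :=
  sInf { c : EReal | ∃ (T : ℝ) (u : ℝ × ℝ → E), 0 < T ∧ MemW12Cyl T N u ∧
    (∀ s, u (s, 0) = γ s) ∧ (∀ s, u (s, T) = β s) ∧
    c = ((cylEnergy T u - (minLength N γ) ^ 2 / (8 * Real.pi ^ 2) * (tp * T) : ℝ) : EReal) }

/-- The boundary of `Ω` is locally the graph of a Lipschitz function. -/
def HasLipschitzBoundary (Ω : Set R2) : Prop :=
  ∀ x ∈ frontier Ω, ∃ (r : ℝ) (f : ℝ → ℝ) (K : ℝ≥0) (e : R2 ≃ₗᵢ[ℝ] R2),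
    0 < r ∧ LipschitzWith K f ∧
    ∀ y ∈ Metric.ball x r,
      (y ∈ Ω ↔ f (((EuclideanSpace.equiv (Fin 2) ℝ) (e (y - x))) 0)
        < ((EuclideanSpace.equiv (Fin 2) ℝ) (e (y - x))) 1)

/-- A bounded Lipschitz domain in the plane. -/
def IsLipschitzDomain (Ω : Set R2) : Prop :=
  IsOpen Ω ∧ IsConnected Ω ∧ Bornology.IsBounded Ω ∧ HasLipschitzBoundary Ω

/-- The radius `ρ̄(a₁, …, a_k)`. -/
def rbar (Ω : Set R2) {ι : Type*} (a : ι → R2) : ℝ :=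
  sInf ({ d : ℝ | ∃ i j, i ≠ j ∧ d = dist (a i) (a j) / 2 }
    ∪ { d : ℝ | ∃ i, d = Metric.infDist (a i) Ωᶜ })

/-- `(γ_i)` is a topological resolution of the boundary datum `g` (Sobolev version). -/
def IsTopResolutionW (Ω : Set R2) (N : Set E) (g : R2 → E) {ι : Type*} (γ : ι → ℝ → E) : Prop :=
  ∃ (a : ι → R2) (ρ : ℝ), (∀ i, a i ∈ Ω) ∧ Function.Injective a ∧ 0 < ρ ∧ ρ < rbar Ω a ∧
    ∃ u : R2 → E, MemW12 (Ω \ ⋃ i, Metric.closedBall (a i) ρ) N u ∧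
      (∀ x ∈ frontier Ω, u x = g x) ∧ ∀ i t, u (a i + ρ • sc t) = γ i t

/-- The singular energy `E^sg(g)` of a boundary datum. -/
def Esg (Ω : Set R2) (N : Set E) (g : R2 → E) : ℝ :=
  sInf { c : ℝ | ∃ (k : ℕ) (γ : Fin k → ℝ → E), 0 < k ∧ IsTopResolutionW Ω N g γ ∧
    c = ∑ i, (minLength N (γ i)) ^ 2 / (4 * Real.pi) }

/-- A minimal topological resolution of `g`. -/
def IsMinimalTopResolution (Ω : Set R2) (N : Set E) (g : R2 → E) {ι : Type*} [Fintype ι]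
    (γ : ι → ℝ → E) : Prop :=
  IsTopResolutionW Ω N g γ ∧
  (∑ i, (minLength N (γ i)) ^ 2 / (4 * Real.pi)) = Esg Ω N g ∧
  ∀ i, 0 < minLength N (γ i)

/-- The geometrical energy outside disks `E^{geom,ρ}`. -/
def Egeomρ (Ω : Set R2) (N : Set E) (g : R2 → E) {ι : Type*} (γ : ι → ℝ → E)
    (a : ι → R2) (ρ : ℝ) : ℝ :=
  sInf { c : ℝ | ∃ u : R2 → E, MemW12 (Ω \ ⋃ i, Metric.closedBall (a i) ρ) N u ∧
    (∀ x ∈ frontier Ω, u x = g x) ∧ (∀ i t, u (a i + ρ • sc t) = γ i t) ∧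
    c = dirE (Ω \ ⋃ i, Metric.closedBall (a i) ρ) u }

/-- The topological energy outside disks `E^{top,ρ}`. -/
def Etopρ (Ω : Set R2) (N : Set E) (g : R2 → E) {ι : Type*} (γ : ι → ℝ → E)
    (a : ι → R2) (ρ : ℝ) : ℝ :=
  sInf { c : ℝ | ∃ u : R2 → E, MemW12 (Ω \ ⋃ i, Metric.closedBall (a i) ρ) N u ∧
    (∀ x ∈ frontier Ω, u x = g x) ∧
    (∀ i, VMOHomotopic N (fun t => u (a i + ρ • sc t)) (γ i)) ∧
    c = dirE (Ω \ ⋃ i, Metric.closedBall (a i) ρ) u }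

/-- The logarithmic correction `∑ λ(γ_i)²/(4π) log(1/ρ)`. -/
def renCor (N : Set E) {ι : Type*} [Fintype ι] (γ : ι → ℝ → E) (ρ : ℝ) : ℝ :=
  (∑ i, (minLength N (γ i)) ^ 2 / (4 * Real.pi)) * Real.log (1 / ρ)

/-- The geometrical renormalised energy `E^{geom}`. -/
def Egeom (Ω : Set R2) (N : Set E) (g : R2 → E) {ι : Type*} [Fintype ι] (γ : ι → ℝ → E)
    (a : ι → R2) : ℝ :=
  sInf { c : ℝ | ∃ ρ ∈ Set.Ioo (0:ℝ) (rbar Ω a), c = Egeomρ Ω N g γ a ρ - renCor N γ ρ }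

/-- The topological renormalised energy `E^{top}`. -/
def Etop (Ω : Set R2) (N : Set E) (g : R2 → E) {ι : Type*} [Fintype ι] (γ : ι → ℝ → E)
    (a : ι → R2) : ℝ :=
  sSup { c : ℝ | ∃ ρ ∈ Set.Ioo (0:ℝ) (rbar Ω a), c = Etopρ Ω N g γ a ρ - renCor N γ ρ }

/-- `u` is an `N`-valued minimising harmonic map in `A` with respect to its own
boundary conditions. -/
def IsMinimizingMap (A : Set R2) (N : Set E) (u : R2 → E) : Prop :=
  MemW12 A N u ∧ ∀ v : R2 → E, MemW12 A N v → (∀ x ∈ frontier A, v x = u x) →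
    dirE A u ≤ dirE A v

/-- The renormalised energy `E^{ren}(u)` of a map relative to the singular set `S`. -/
def renE (Ω : Set R2) (N : Set E) (S : Finset R2) (u : R2 → E) : EReal :=
  Filter.liminf
    (fun ρ : ℝ => ((dirE (Ω \ ⋃ a ∈ S, Metric.closedBall a ρ) u
      - ∑ a ∈ S, (minLength N (fun t => u (a + ρ • sc t))) ^ 2 / (4 * Real.pi)
          * Real.log (1 / ρ) : ℝ) : EReal))
    (nhdsWithin 0 (Set.Ioi 0))

/-- `u` is a renormalisable map: `u ∈ W^{1,2}_{ren}(Ω, N)`. -/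
def MemW12ren (Ω : Set R2) (N : Set E) (u : R2 → E) : Prop :=
  ∃ S : Finset R2, ↑S ⊆ Ω ∧
    (∃ ρ₀ > (0:ℝ), ∀ ρ ∈ Set.Ioo (0:ℝ) ρ₀,
      MemW12 (Ω \ ⋃ a ∈ S, Metric.closedBall a ρ) N u) ∧
    renE Ω N S u < ⊤

/-- `sing(u) = {(a_i, γ_i)}`. -/
def HasSingularities (Ω : Set R2) (N : Set E) (u : R2 → E) {ι : Type*} (a : ι → R2)
    (γ : ι → ℝ → E) : Prop :=
  Function.Injective a ∧ (∀ i, a i ∈ Ω) ∧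
  (∀ x ∈ closure Ω, x ∉ Set.range a → ∃ ε > (0:ℝ), MemW12 (Ω ∩ Metric.ball x ε) N u) ∧
  (∀ i, Tendsto (fun ρ : ℝ => synhar N (fun t => u (a i + ρ • sc t)) (γ i))
      (nhdsWithin 0 (Set.Ioi 0)) (nhds 0)) ∧
  (∀ i, ¬ ∃ y : E, VMOHomotopic N (γ i) (fun _ => y))

end Paper

open Matrix

namespace Paper

variable {d : ℕ}

/-- The matrix exponential. -/
def mexp (A : Matrix (Fin d) (Fin d) ℂ) : Matrix (Fin d) (Fin d) ℂ :=
  ∑' n : ℕ, ((n.factorial : ℂ)⁻¹) • A ^ n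

/-- The Frobenius norm of a complex matrix, inducing the bi-invariant metric of `SU(d)`. -/
def fnorm (A : Matrix (Fin d) (Fin d) ℂ) : ℝ :=
  Real.sqrt (∑ i, ∑ j, ‖A i j‖ ^ 2)

/-- The Lie algebra `𝔰𝔲(d)` of skew-Hermitian traceless matrices. -/
def memSU (A : Matrix (Fin d) (Fin d) ℂ) : Prop :=
  Aᴴ = -A ∧ A.trace = 0

end Paper

open Paper

namespace Paper

theorem mexp_eq (A : Matrix (Fin d) (Fin d) ℂ) : mexp A = NormedSpace.exp A := by
  rw [NormedSpace.exp_eq_tsum ℂ]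
  rfl

theorem exists_perm_of_sums {α : Type*} [DecidableEq α] (x y : Fin d → α)
    (h : ∀ f : α → ℤ, ∑ j, f (x j) = ∑ j, f (y j)) :
    ∃ τ : Equiv.Perm (Fin d), ∀ j, y (τ j) = x j := by
  have e : ∀ c, Nonempty ({a // x a = c} ≃ {b // y b = c}) := by
    intro c
    rw [← Fintype.card_eq, Fintype.card_subtype, Fintype.card_subtype]
    have := h (fun z => if z = c then 1 else 0)
    simp only [Finset.sum_boole] at this
    exact_mod_cast this
  exact ⟨Equiv.ofFiberEquiv (fun c => (e c).some), fun j => Equiv.ofFiberEquiv_map _ j⟩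

theorem exists_perm_of_charpoly (x y : Fin d → ℂ)
    (h : (diagonal x).charpoly = (diagonal y).charpoly) :
    ∃ τ : Equiv.Perm (Fin d), ∀ j, y (τ j) = x j := by
  rw [charpoly_diagonal, charpoly_diagonal] at h
  have h2 : Finset.univ.val.map x = Finset.univ.val.map y := by
    have key : ∀ z : Fin d → ℂ,
        (∏ i, (Polynomial.X - Polynomial.C (z i))).roots = Finset.univ.val.map z := by
      intro z
      have := Polynomial.roots_multiset_prod_X_sub_C (Finset.univ.val.map z)
      rw [Multiset.map_map] at this
      exact this
    rw [← key, ← key, h]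
  apply exists_perm_of_sums
  intro f
  have := congrArg (fun m => (m.map f).sum) h2
  simp only [Multiset.map_map] at this
  exact this

/-- The combinatorial core. -/
theorem window_perm (x y : Fin d → ℝ) (n : Fin d → ℤ) (hn : ∀ j, y j = x j + 2 * Real.pi * n j)
    (hxs : ∑ j, x j = 0) (hys : ∑ j, y j = 0)
    (hx : ∀ i j, x j - x i ≤ 2 * Real.pi) (hy : ∀ i j, y j - y i ≤ 2 * Real.pi) :
    ∃ τ : Equiv.Perm (Fin d), ∀ j, y (τ j) = x j := by
  have hpi := Real.pi_pos
  have hns : ∑ j, n j = 0 := by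
    have h : ∑ j, y j = ∑ j, x j + 2 * Real.pi * ∑ j, (n j : ℝ) := by
      rw [Finset.mul_sum, ← Finset.sum_add_distrib]
      exact Finset.sum_congr rfl fun j _ => hn j
    rw [hxs, hys] at h
    have h' : ∑ j, (n j : ℝ) = 0 := by
      rcases mul_eq_zero.1 (by linarith : 2 * Real.pi * ∑ j, (n j : ℝ) = 0) with h | h
      · linarith
      · exact h
    exact_mod_cast h'
  have pair : ∀ i j, 0 < n j → n i < 0 → n j = 1 ∧ n i = -1 ∧ x i = x j + 2 * Real.pi := by
    intro i j hj hi
    have a := hx j i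
    have b := hy i j
    rw [hn, hn] at b
    have c : n j - n i ≤ 2 := by
      have : 2 * Real.pi * ((n j : ℝ) - n i) ≤ 2 * Real.pi * 2 := by nlinarith
      have := le_of_mul_le_mul_left this (by positivity)
      exact_mod_cast this
    have e1 : n j = 1 := by omega
    have e2 : n i = -1 := by omega
    refine ⟨e1, e2, ?_⟩
    rw [e1, e2] at b
    push_cast at b
    linarith
  by_cases hall : ∀ j, n j = 0
  · exact ⟨1, fun j => by simp [hn j, hall j]⟩
  push Not at hall
  have hpos : ∃ j, 0 < n j := by
    by_contra hc
    push Not at hc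
    obtain ⟨j, hj⟩ := hall
    exact hj ((Finset.sum_eq_zero_iff_of_nonpos (fun i _ => hc i)).1 hns j (Finset.mem_univ _))
  have hneg : ∃ j, n j < 0 := by
    by_contra hc
    push Not at hc
    obtain ⟨j, hj⟩ := hall
    exact hj ((Finset.sum_eq_zero_iff_of_nonneg (fun i _ => hc i)).1 hns j (Finset.mem_univ _))
  obtain ⟨p, hp⟩ := hpos
  obtain ⟨q, hq⟩ := hneg
  obtain ⟨hp1, hq1, hpq⟩ := pair q p hp hq
  classical
  apply exists_perm_of_sums
  intro f
  have key : ∀ j, f (y j) = f (x j) + n j * (f (x q) - f (x p)) := by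
    intro j
    rcases lt_trichotomy (n j) 0 with h | h | h
    · obtain ⟨_, h2, h3⟩ := pair j p hp h
      have : y j = x p := by rw [hn, h2, h3]; push_cast; ring
      rw [this, h2, h3, hpq]; ring
    · rw [hn, h]; simp
    · obtain ⟨h2, _, h3⟩ := pair q j h hq
      have e : y j = x q := by rw [hn, h2, h3]; push_cast; ring
      have e2 : x j = x p := by linarith
      rw [e, h2, e2]; ring
  simp_rw [key]
  rw [Finset.sum_add_distrib, ← Finset.sum_mul, hns]
  simp

theorem fnorm_sq (A : Matrix (Fin d) (Fin d) ℂ) :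
    ((∑ i, ∑ j, ‖A i j‖ ^ 2 : ℝ) : ℂ) = (Aᴴ * A).trace := by
  rw [Matrix.trace, Finset.sum_comm]
  push_cast
  refine Finset.sum_congr rfl fun i _ => ?_
  rw [diag_apply, mul_apply]
  refine Finset.sum_congr rfl fun j _ => ?_
  rw [conjTranspose_apply, Complex.star_def, Complex.conj_mul']

theorem fnorm_conj (U A : Matrix (Fin d) (Fin d) ℂ) (hU : Uᴴ * U = 1) :
    fnorm (U * A * Uᴴ) = fnorm A := by
  unfold fnorm
  congr 1
  apply Complex.ofReal_injective
  rw [fnorm_sq, fnorm_sq]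
  have : (U * A * Uᴴ)ᴴ * (U * A * Uᴴ) = U * (Aᴴ * A) * Uᴴ := by
    simp only [conjTranspose_mul, conjTranspose_conjTranspose]
    calc _ = U * (Aᴴ * (Uᴴ * U) * A) * Uᴴ := by simp only [Matrix.mul_assoc]
      _ = _ := by rw [hU, Matrix.mul_one]
  rw [this, Matrix.trace_mul_comm, ← Matrix.mul_assoc, hU, Matrix.one_mul]

theorem fnorm_diag (x : Fin d → ℝ) :
    fnorm (diagonal fun j => Complex.I * (x j : ℂ)) = Real.sqrt (∑ j, x j ^ 2) := by
  unfold fnorm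
  congr 1
  refine Finset.sum_congr rfl fun i _ => ?_
  rw [Finset.sum_eq_single i]
  · simp
  · intro j _ hj
    simp [diagonal_apply_ne' _ hj]
  · simp

theorem mexp_conj (U A : Matrix (Fin d) (Fin d) ℂ) (hU : Uᴴ * U = 1) :
    mexp (U * A * Uᴴ) = U * mexp A * Uᴴ := by
  have hinv : U⁻¹ = Uᴴ := inv_eq_left_inv hU
  rw [mexp_eq, mexp_eq, ← hinv]
  exact Matrix.exp_conj U A ((isUnit_iff_exists_inv').2 ⟨_, hU⟩)

theorem mexp_diag (v : Fin d → ℂ) :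
    mexp (diagonal v) = diagonal fun j => Complex.exp (v j) := by
  rw [mexp_eq, Matrix.exp_diagonal]
  congr 1
  ext j
  rw [Pi.coe_exp, Complex.exp_eq_exp_ℂ]

theorem exists_diag (σ : Matrix (Fin d) (Fin d) ℂ) (h : memSU σ) :
    ∃ (U : Matrix (Fin d) (Fin d) ℂ) (x : Fin d → ℝ), Uᴴ * U = 1 ∧
      σ = U * (diagonal fun j => Complex.I * (x j : ℂ)) * Uᴴ ∧ ∑ j, x j = 0 := by
  have hH : ((-Complex.I) • σ).IsHermitian := by
    rw [Matrix.IsHermitian, conjTranspose_smul, h.1]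
    simp
  have hU : (hH.eigenvectorUnitary : Matrix (Fin d) (Fin d) ℂ)ᴴ * hH.eigenvectorUnitary = 1 :=
    Unitary.coe_star_mul_self hH.eigenvectorUnitary
  have hs : σ = (hH.eigenvectorUnitary : Matrix (Fin d) (Fin d) ℂ) *
      (diagonal fun j => Complex.I * (hH.eigenvalues j : ℂ)) *
      (hH.eigenvectorUnitary : Matrix (Fin d) (Fin d) ℂ)ᴴ := by
    have h1 := hH.spectral_theorem
    rw [Unitary.conjStarAlgAut_apply] at h1
    have h2 : σ = Complex.I • ((-Complex.I) • σ) := by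
      rw [smul_smul]; simp
    have h3 : (diagonal fun j => Complex.I * (hH.eigenvalues j : ℂ))
        = Complex.I • diagonal (RCLike.ofReal ∘ hH.eigenvalues : Fin d → ℂ) := by
      rw [← diagonal_smul]; rfl
    rw [h3, Matrix.mul_smul, Matrix.smul_mul]
    conv_lhs => rw [h2, h1]
    rfl
  refine ⟨_, _, hU, hs, ?_⟩
  have ht := h.2
  rw [hs, Matrix.trace_mul_comm, ← Matrix.mul_assoc, hU, Matrix.one_mul, trace_diagonal,
    ← Finset.mul_sum] at ht
  have := (mul_eq_zero.1 ht).resolve_left Complex.I_ne_zero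
  exact_mod_cast this

theorem memSU_conj (U A : Matrix (Fin d) (Fin d) ℂ) (hU : Uᴴ * U = 1) (hA : memSU A) :
    memSU (U * A * Uᴴ) := by
  constructor
  · simp only [conjTranspose_mul, conjTranspose_conjTranspose, hA.1]
    simp [Matrix.mul_assoc]
  · rw [Matrix.trace_mul_comm, ← Matrix.mul_assoc, hU, Matrix.one_mul, hA.2]

theorem memSU_diag (x : Fin d → ℝ) (hx : ∑ j, x j = 0) :
    memSU (diagonal fun j => Complex.I * (x j : ℂ)) := by
  constructor
  · rw [diagonal_conjTranspose, diagonal_neg]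
    congr 1
    ext j
    simp
  · rw [trace_diagonal, ← Finset.mul_sum, ← Complex.ofReal_sum, hx]
    simp

/-- Minimality forces the eigenvalues into a window of length `2π`. -/
theorem window (g U : Matrix (Fin d) (Fin d) ℂ) (x : Fin d → ℝ) (hU : Uᴴ * U = 1)
    (hx : ∑ j, x j = 0)
    (h : mexp (U * (diagonal fun j => Complex.I * (x j : ℂ)) * Uᴴ) = g)
    (hmin : ∀ σ, memSU σ → mexp σ = g →
      fnorm (U * (diagonal fun j => Complex.I * (x j : ℂ)) * Uᴴ) ≤ fnorm σ) (i j : Fin d) :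
    x j - x i ≤ 2 * Real.pi := by
  have hpi := Real.pi_pos
  by_cases hij : i = j
  · subst hij; simp; positivity
  let n : Fin d → ℤ := Pi.single i 1 - Pi.single j 1
  let x' : Fin d → ℝ := fun k => x k + 2 * Real.pi * n k
  have hns : ∑ k, (n k : ℝ) = 0 := by
    have : ∑ k, n k = 0 := by simp [n, Finset.sum_sub_distrib]
    exact_mod_cast this
  have hx' : ∑ k, x' k = 0 := by
    simp only [x', Finset.sum_add_distrib, ← Finset.mul_sum, hns, hx]; simp
  have he : mexp (U * (diagonal fun j => Complex.I * (x' j : ℂ)) * Uᴴ) = g := by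
    rw [← h, mexp_conj _ _ hU, mexp_conj _ _ hU, mexp_diag, mexp_diag]
    congr 3
    ext k
    rw [Complex.exp_eq_exp_iff_exists_int]
    refine ⟨n k, ?_⟩
    simp only [x']; push_cast; ring
  have hm := hmin _ (memSU_conj _ _ hU (memSU_diag x' hx')) he
  rw [fnorm_conj _ _ hU, fnorm_conj _ _ hU, fnorm_diag, fnorm_diag,
    Real.sqrt_le_sqrt_iff (Finset.sum_nonneg fun _ _ => sq_nonneg _)] at hm
  have e1 : ∑ k, x' k ^ 2 = ∑ k, x k ^ 2 + 4 * Real.pi * ∑ k, x k * n k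
      + 4 * Real.pi ^ 2 * ∑ k, (n k : ℝ) ^ 2 := by
    rw [Finset.mul_sum, Finset.mul_sum, ← Finset.sum_add_distrib, ← Finset.sum_add_distrib]
    refine Finset.sum_congr rfl fun k _ => ?_
    simp only [x']; ring
  have e0 : ∀ k, (n k : ℝ) = (if k = i then 1 else 0) - (if k = j then 1 else 0) := by
    intro k
    simp only [n, Pi.sub_apply, Pi.single_apply]
    push_cast
    rfl
  have e2 : ∑ k, x k * n k = x i - x j := by
    simp [e0, mul_sub, Finset.sum_sub_distrib]
  have e3 : ∑ k, (n k : ℝ) ^ 2 = 2 := by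
    have : ∀ k, (n k : ℝ) ^ 2 = (if k = i then 1 else 0) + (if k = j then 1 else 0) := by
      intro k
      rw [e0]
      by_cases h1 : k = i
      · have h2 : k ≠ j := fun h => hij (h1.symm.trans h)
        simp [h1, hij]
      · by_cases h2 : k = j <;> simp [h1, h2, Ne.symm hij]
    simp only [this, Finset.sum_add_distrib]
    simp; norm_num
  rw [e1, e2, e3] at hm
  by_contra hc
  push Not at hc
  nlinarith

theorem diag_perm (x y : Fin d → ℝ) (τ : Equiv.Perm (Fin d)) (h : ∀ j, y (τ j) = x j)
    (V : Matrix (Fin d) (Fin d) ℂ) (hV : Vᴴ * V = 1) :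
    ∃ V' : Matrix (Fin d) (Fin d) ℂ, V'ᴴ * V' = 1 ∧
      V * (diagonal fun j => Complex.I * (y j : ℂ)) * Vᴴ
        = V' * (diagonal fun j => Complex.I * (x j : ℂ)) * V'ᴴ := by
  refine ⟨V.submatrix id τ, ?_, ?_⟩
  · rw [conjTranspose_submatrix, ← submatrix_mul _ _ _ _ _ Function.bijective_id, hV,
      submatrix_one_equiv]
  · have : (diagonal fun j => Complex.I * (x j : ℂ))
        = (diagonal fun j => Complex.I * (y j : ℂ)).submatrix τ τ := by
      rw [submatrix_diagonal_equiv]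
      congr 1
      ext j
      simp [h j]
    rw [this, conjTranspose_submatrix, ← submatrix_mul _ _ _ _ _ τ.bijective,
      ← submatrix_mul _ _ _ _ _ τ.bijective, submatrix_id_id]

open scoped Matrix.Norms.L2Operator in
theorem exists_log (W g : Matrix (Fin d) (Fin d) ℂ) (hW : Wᴴ * W = 1) (hc : Commute W g)
    (hc' : Commute Wᴴ g) :
    ∃ ξ : Matrix (Fin d) (Fin d) ℂ, ξᴴ = -ξ ∧ NormedSpace.exp ξ = W ∧ Commute ξ g := by
  have hW' : W * Wᴴ = 1 := mul_eq_one_comm.1 hW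
  have hu : W ∈ unitary (Matrix (Fin d) (Fin d) ℂ) := Unitary.mem_iff.2 ⟨hW, hW'⟩
  have hn : IsStarNormal W := ⟨hW.trans hW'.symm⟩
  have hcont : ∀ (f : ℂ → ℂ), ContinuousOn f (spectrum ℂ W) :=
    fun f => W.finite_spectrum.continuousOn f
  have hnorm : ∀ z ∈ spectrum ℂ W, ‖z‖ = 1 := fun z hz => by
    simpa using spectrum.subset_circle_of_unitary hu hz
  refine ⟨cfc Complex.log W, ?_, ?_, ?_⟩
  · rw [← star_eq_conjTranspose, ← cfc_star, ← cfc_neg]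
    apply cfc_congr
    intro z hz
    simp only [Complex.star_def]
    apply Complex.ext
    · simp [Complex.log_re, hnorm z hz]
    · simp
  · rw [← CFC.complex_exp_eq_normedSpace_exp (cfc_predicate _ _),
      ← cfc_comp' Complex.exp Complex.log W (by fun_prop) (hcont _)]
    conv_rhs => rw [← cfc_id' ℂ W]
    apply cfc_congr
    intro z hz
    apply Complex.exp_log
    intro h0
    have := hnorm z hz
    simp [h0] at this
  · exact Commute.cfc hc hc' _

end Paper

/-- Two minimising geodesics `γ₀, γ₁` of `SU(d)` (with its bi-invariant
metric) from the identity to `g`, i.e. `γ_k(s) = exp(s σ_k)` with `σ_k ∈ 𝔰𝔲(d)` of minimal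
norm among logarithms of `g`, are conjugate: there is `ξ ∈ 𝔰𝔲(d)` with
`g = exp(tξ) g exp(−tξ)` for all `t ∈ [0,1]` and `γ₁(s) = exp(ξ) γ₀(s) exp(−ξ)`; moreover
`γ₀` is homotopied to `γ₁` through the minimising geodesics
`γ_t(s) = exp(tξ) γ₀(s) exp(−tξ)`. -/
theorem statement19 (d : ℕ) (hd : 2 ≤ d)
    (g : Matrix (Fin d) (Fin d) ℂ) (hgU : gᴴ * g = 1) (hgdet : g.det = 1)
    (σ₀ σ₁ : Matrix (Fin d) (Fin d) ℂ)
    (hσ₀ : memSU σ₀) (hσ₁ : memSU σ₁)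
    (h₀ : mexp σ₀ = g) (h₁ : mexp σ₁ = g)
    (hmin₀ : ∀ σ, memSU σ → mexp σ = g → fnorm σ₀ ≤ fnorm σ)
    (hmin₁ : ∀ σ, memSU σ → mexp σ = g → fnorm σ₁ ≤ fnorm σ) :
    ∃ ξ : Matrix (Fin d) (Fin d) ℂ, memSU ξ ∧
      (∀ t : ℝ, t ∈ Set.Icc (0:ℝ) 1 →
        mexp ((t : ℂ) • ξ) * g * mexp (-((t : ℂ) • ξ)) = g) ∧
      (∀ s : ℝ, s ∈ Set.Icc (0:ℝ) 1 →
        mexp ((s : ℂ) • σ₁) = mexp ξ * mexp ((s : ℂ) • σ₀) * mexp (-ξ)) ∧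
      (∀ t : ℝ, t ∈ Set.Icc (0:ℝ) 1 →
        ∃ σt : Matrix (Fin d) (Fin d) ℂ, memSU σt ∧ mexp σt = g ∧
          fnorm σt = fnorm σ₀ ∧
          (∀ σ, memSU σ → mexp σ = g → fnorm σt ≤ fnorm σ) ∧
          ∀ s : ℝ, mexp ((t : ℂ) • ξ) * mexp ((s : ℂ) • σ₀) * mexp (-((t : ℂ) • ξ))
            = mexp ((s : ℂ) • σt)) := by
  obtain ⟨U, x, hU, hUx, hxs⟩ := exists_diag σ₀ hσ₀
  obtain ⟨V, y, hV, hVy, hys⟩ := exists_diag σ₁ hσ₁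
  have wx := window g U x hU hxs (by rw [← hUx]; exact h₀) (by rw [← hUx]; exact hmin₀)
  have wy := window g V y hV hys (by rw [← hVy]; exact h₁) (by rw [← hVy]; exact hmin₁)
  have hch : (diagonal fun j => Complex.exp (Complex.I * (x j : ℂ))).charpoly
      = (diagonal fun j => Complex.exp (Complex.I * (y j : ℂ))).charpoly := by
    have key : ∀ (P D : Matrix (Fin d) (Fin d) ℂ), Pᴴ * P = 1 →
        (P * D * Pᴴ).charpoly = D.charpoly := by
      intro P D hP
      rw [Matrix.charpoly_mul_comm, ← Matrix.mul_assoc, hP, Matrix.one_mul]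
    rw [← key U _ hU, ← key V (diagonal fun j => Complex.exp (Complex.I * (y j : ℂ))) hV, ← mexp_diag, ← mexp_diag, ← mexp_conj _ _ hU,
      ← mexp_conj _ _ hV, ← hUx, ← hVy, h₀, h₁]
  obtain ⟨τ, hτ⟩ := exists_perm_of_charpoly _ _ hch
  have hn : ∀ j, ∃ n : ℤ, y (τ j) = x j + 2 * Real.pi * n := by
    intro j
    obtain ⟨n, hn⟩ := Complex.exp_eq_exp_iff_exists_int.1 (hτ j)
    refine ⟨n, ?_⟩
    have h2 : Complex.I * (y (τ j) : ℂ) = Complex.I * ((x j + 2 * Real.pi * n : ℝ) : ℂ) := by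
      rw [hn]; push_cast; ring
    exact Complex.ofReal_injective (mul_left_cancel₀ Complex.I_ne_zero h2)
  choose n hn using hn
  obtain ⟨τ', hτ'⟩ := window_perm x (fun j => y (τ j)) n hn hxs
    (by rw [Equiv.sum_comp τ y]; exact hys) wx (fun i j => wy _ _)
  obtain ⟨V', hV', hVV⟩ := diag_perm x y (τ'.trans τ) (fun j => hτ' j) V hV
  rw [← hVy] at hVV
  have hU2 : U * Uᴴ = 1 := mul_eq_one_comm.1 hU
  obtain ⟨W, hWdef⟩ : ∃ W, W = V' * Uᴴ := ⟨_, rfl⟩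
  have hWs : Wᴴ = U * V'ᴴ := by rw [hWdef]; simp
  have hW : Wᴴ * W = 1 := by
    rw [hWs, hWdef]
    calc _ = U * (V'ᴴ * V') * Uᴴ := by simp only [Matrix.mul_assoc]
      _ = 1 := by rw [hV', Matrix.mul_one, hU2]
  have hW2 : W * Wᴴ = 1 := mul_eq_one_comm.1 hW
  have hWσ : σ₁ = W * σ₀ * Wᴴ := by
    rw [hVV, hUx, hWs, hWdef]
    calc _ = V' * 1 * (diagonal fun j => Complex.I * (x j : ℂ)) * 1 * V'ᴴ := by
          rw [Matrix.mul_one, Matrix.mul_one]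
      _ = _ := by rw [← hU]; simp only [Matrix.mul_assoc]
  have hWg : W * g * Wᴴ = g := by
    conv_lhs => rw [← h₀]
    rw [← mexp_conj _ _ hW, ← hWσ, h₁]
  have hc : Commute W g := by
    calc W * g = W * g * (Wᴴ * W) := by rw [hW, Matrix.mul_one]
      _ = (W * g * Wᴴ) * W := by simp only [Matrix.mul_assoc]
      _ = g * W := by rw [hWg]
  have hc' : Commute Wᴴ g := by
    calc Wᴴ * g = Wᴴ * (W * g * Wᴴ) := by rw [hWg]
      _ = (Wᴴ * W) * g * Wᴴ := by simp only [Matrix.mul_assoc]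
      _ = g * Wᴴ := by rw [hW, Matrix.one_mul]
  obtain ⟨η, hη, hηW, hηg⟩ := exists_log W g hW hc hc'
  have hd0 : (d : ℂ) ≠ 0 := by
    have : d ≠ 0 := by omega
    exact_mod_cast this
  obtain ⟨c, hcdef⟩ : ∃ c : ℂ, c = η.trace / d := ⟨_, rfl⟩
  have hcs : star c = -c := by
    have h1 : star η.trace = -η.trace := by
      rw [← trace_conjTranspose, hη, trace_neg]
    rw [hcdef, star_div₀, h1]
    simp [neg_div]
  let ξ : Matrix (Fin d) (Fin d) ℂ := η - c • 1
  have hξ : memSU ξ := by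
    constructor
    · simp only [ξ, conjTranspose_sub, conjTranspose_smul, hη, conjTranspose_one, hcs, neg_smul]
      abel
    · simp only [ξ, trace_sub, trace_smul, trace_one, Fintype.card_fin, smul_eq_mul, hcdef]
      field_simp
      ring
  have hξg : Commute ξ g :=
    hηg.sub_left ((Commute.one_left g).smul_left c)
  -- properties of `exp (tξ)`
  have hEstar : ∀ t : ℝ, (mexp ((t : ℂ) • ξ))ᴴ = mexp (-((t : ℂ) • ξ)) := by
    intro t
    rw [mexp_eq, mexp_eq, ← Matrix.exp_conjTranspose, conjTranspose_smul, hξ.1]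
    simp
  have hEinv : ∀ A : Matrix (Fin d) (Fin d) ℂ, mexp (-A) * mexp A = 1 := by
    intro A
    rw [mexp_eq, mexp_eq, ← Matrix.exp_add_of_commute _ _ (Commute.neg_left (Commute.refl A))]
    simp
  have hEU : ∀ t : ℝ, (mexp ((t : ℂ) • ξ))ᴴ * mexp ((t : ℂ) • ξ) = 1 := by
    intro t
    rw [hEstar, hEinv]
  have hconj : ∀ t : ℝ, mexp ((t : ℂ) • ξ) * g * mexp (-((t : ℂ) • ξ)) = g := by
    intro t
    have h2 : Commute (mexp ((t : ℂ) • ξ)) g := by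
      rw [mexp_eq]
      exact (hξg.smul_left (t : ℂ)).exp_left
    rw [h2.eq, Matrix.mul_assoc, mul_eq_one_comm.1 (hEinv _), Matrix.mul_one]
  have hξexp : mexp ξ = Complex.exp (-c) • W := by
    have h1 : ξ = η + (-c) • 1 := by simp only [ξ]; rw [neg_smul, sub_eq_add_neg]
    have h2 : NormedSpace.exp ((-c) • (1 : Matrix (Fin d) (Fin d) ℂ))
        = Complex.exp (-c) • 1 := by
      rw [← mexp_eq, smul_one_eq_diagonal, mexp_diag, smul_one_eq_diagonal]
    rw [mexp_eq, h1, Matrix.exp_add_of_commute _ _ ((Commute.one_right η).smul_right (-c)), hηW,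
      h2, Matrix.mul_smul, Matrix.mul_one]
  have hξconj : ∀ A : Matrix (Fin d) (Fin d) ℂ, mexp ξ * A * mexp (-ξ) = W * A * Wᴴ := by
    intro A
    have h1 : mexp (-ξ) = (mexp ξ)ᴴ := by
      have := hEstar 1
      simpa using this.symm
    have h3 : Complex.exp (-c) * star (Complex.exp (-c)) = 1 := by
      rw [Complex.star_def, ← Complex.exp_conj, ← Complex.star_def, star_neg, hcs,
        ← Complex.exp_add]
      simp
    rw [h1, hξexp, conjTranspose_smul, Matrix.smul_mul, Matrix.smul_mul, Matrix.mul_smul,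
      smul_smul, h3, one_smul]
  refine ⟨ξ, hξ, fun t _ => hconj t, ?_, ?_⟩
  · intro s _
    rw [hξconj, ← mexp_conj _ _ hW, hWσ, Matrix.mul_smul, Matrix.smul_mul]
  · intro t _
    have hf := fnorm_conj (mexp ((t : ℂ) • ξ)) σ₀ (hEU t)
    refine ⟨mexp ((t : ℂ) • ξ) * σ₀ * (mexp ((t : ℂ) • ξ))ᴴ, memSU_conj _ _ (hEU t) hσ₀, ?_, hf,
      ?_, ?_⟩
    · rw [mexp_conj _ _ (hEU t), h₀, hEstar, hconj]
    · intro σ hσ hσg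
      rw [hf]
      exact hmin₀ σ hσ hσg
    · intro s
      rw [← hEstar, ← mexp_conj _ _ (hEU t), Matrix.mul_smul, Matrix.smul_mul]
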